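/- Let G be a connected multigraph embedded in a surface without crossings, where each face is bounded by a cycle, and let d ≥ 3 be an integer. Then every two vertices u, v that are adjacent in G^{(d)} satisfy dist_G(u,v) ≤ ⌊d/2⌋. Consequently, if (V₀, V₁, …) is a BFS layering of G and L_j := V_{j⌊d/2⌋} ∪ ⋯ ∪ V_{(j+1)⌊d/2⌋ − 1} for each j ∈ ℕ, then (L₀, L₁, …) is a layering of G^{(d)}. -/

import Mathlib

/-!
Common definitions: multigraphs, combinatorial (cellular) surface embeddings,
Euler genus, framed graphs, strong products, treewidth, partitions and layerings.
-/

/-- A multigraph on vertex type `V` with edge type `E`, given by its endpoints map. -/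
structure Multigraph (V E : Type) where
  ends : E → Sym2 V

namespace Multigraph

variable {V E F : Type}

/-- The simple graph underlying a multigraph. -/
def simple (G : Multigraph V E) : SimpleGraph V where
  Adj u v := u ≠ v ∧ ∃ e, G.ends e = s(u, v)
  symm := by
    constructor
    rintro u v ⟨hne, e, he⟩
    exact ⟨hne.symm, e, he.trans Sym2.eq_swap⟩
  loopless := by constructor; rintro u ⟨hne, -⟩; exact hne rfl

/-- The simple graph on `V` whose edges are the edges of `G` lying in `S`. -/
def simpleOn (G : Multigraph V E) (S : Set E) : SimpleGraph V where
  Adj u v := u ≠ v ∧ ∃ e ∈ S, G.ends e = s(u, v)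
  symm := by
    constructor
    rintro u v ⟨hne, e, heS, he⟩
    exact ⟨hne.symm, e, heS, he.trans Sym2.eq_swap⟩
  loopless := by constructor; rintro u ⟨hne, -⟩; exact hne rfl

/-- A multigraph is simple: no loops and no parallel edges. -/
def IsSimple (G : Multigraph V E) : Prop :=
  (∀ e, ¬ (G.ends e).IsDiag) ∧ Function.Injective G.ends

/-- A set `S` of edges of `G` forms a spanning tree of `G`. -/
def IsSpanningTree (G : Multigraph V E) (S : Set E) : Prop :=
  (G.simpleOn S).IsTree ∧ (∀ e ∈ S, ¬ (G.ends e).IsDiag) ∧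
    ∀ e ∈ S, ∀ e' ∈ S, G.ends e = G.ends e' → e = e'

/-- A closed walk in a multigraph, recorded as periodic sequences of vertices and
edges: the walk visits `vtx 0, vtx 1, …, vtx (len - 1)` and returns to
`vtx len = vtx 0`, traversing the edge `edge i` between `vtx i` and `vtx (i+1)`. -/
structure CWalk (G : Multigraph V E) where
  len : ℕ
  len_pos : 0 < len
  vtx : ℕ → V
  edge : ℕ → E
  vtx_per : ∀ i, vtx (i + len) = vtx i
  edge_per : ∀ i, edge (i + len) = edge i
  compat : ∀ i, G.ends (edge i) = s(vtx i, vtx (i + 1))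

namespace CWalk

variable {G : Multigraph V E}

/-- The vertex `v` lies on the closed walk `W`. -/
def HasVtx (W : G.CWalk) (v : V) : Prop := ∃ i, i < W.len ∧ W.vtx i = v

/-- The edge `e` lies on the closed walk `W`. -/
def HasEdge (W : G.CWalk) (e : E) : Prop := ∃ i, i < W.len ∧ W.edge i = e

/-- The closed walk `W` is a cycle: it repeats no vertex and no edge. -/
def IsCycle (W : G.CWalk) : Prop :=
  (∀ i j, i < W.len → j < W.len → W.vtx i = W.vtx j → i = j) ∧
  (∀ i j, i < W.len → j < W.len → W.edge i = W.edge j → i = j)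

end CWalk

/-- `p = (f, i)` is an occurrence of the edge `e` in the family `bd` of closed walks:
the walk of face `f` traverses `e` at position `i`. -/
def IsOcc {G : Multigraph V E} (bd : F → G.CWalk) (e : E) (p : F × ℕ) : Prop :=
  p.2 < (bd p.1).len ∧ (bd p.1).edge p.2 = e

/-- `c = (f, i)` is a corner of the vertex `v`: the walk of face `f` visits `v`
at position `i`. -/
def IsCorner {G : Multigraph V E} (bd : F → G.CWalk) (v : V) (c : F × ℕ) : Prop :=
  c.2 < (bd c.1).len ∧ (bd c.1).vtx c.2 = v

/-- The corner `c` is one of the two end corners of the edge occurrence `p`. -/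
def EndOf {G : Multigraph V E} (bd : F → G.CWalk) (c p : F × ℕ) : Prop :=
  c.1 = p.1 ∧ (c.2 = p.2 ∨ c.2 = (p.2 + 1) % (bd p.1).len)

/-- Two corners of `v` are linked if they are end corners (at `v`) of the two
distinct occurrences of a common edge; this is the edge-to-edge gluing relation
around the vertex `v`. -/
def CornerLinked {G : Multigraph V E} (bd : F → G.CWalk) (v : V) (c c' : F × ℕ) : Prop :=
  IsCorner bd v c ∧ IsCorner bd v c' ∧
    ∃ (e : E) (p p' : F × ℕ), p ≠ p' ∧ IsOcc bd e p ∧ IsOcc bd e p' ∧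
      EndOf bd c p ∧ EndOf bd c' p'

/-- A combinatorial (cellular) embedding of a connected multigraph `G` in a closed
surface, with face set `F`: every face is given by its closed boundary walk, every
edge of `G` is traversed exactly twice in total by the boundary walks, and the link
of every vertex is connected (so the embedding is in a genuine surface, with no
pinch points). -/
structure Embedding (G : Multigraph V E) (F : Type) where
  boundary : F → G.CWalk
  conn : G.simple.Connected
  edge_twice : ∀ e : E, {p : F × ℕ | IsOcc boundary e p}.ncard = 2
  link_conn : ∀ (v : V) (c c' : F × ℕ), IsCorner boundary v c → IsCorner boundary v c' →
    Relation.EqvGen (CornerLinked boundary v) c c'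

/-- The Euler genus `2 - (|V| - |E| + |F|)` of an embedding, via Euler's formula. -/
noncomputable def Embedding.eulerGenus {G : Multigraph V E} {F : Type}
    (_ : Embedding G F) : ℤ :=
  2 - ((Nat.card V : ℤ) - Nat.card E + Nat.card F)

/-- The simple graph underlying the framed multigraph `G^{(d)}`: two distinct
vertices are adjacent iff they are joined by an edge of `G` or lie on a common
face of length at most `d` (in which case `G^{(d)}` has a chord between them). -/
def framedGraph {G : Multigraph V E} {F : Type} (emb : Embedding G F) (d : ℕ) :
    SimpleGraph V where
  Adj u v := u ≠ v ∧ ((∃ e, G.ends e = s(u, v)) ∨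
    ∃ f, (emb.boundary f).len ≤ d ∧ (emb.boundary f).HasVtx u ∧ (emb.boundary f).HasVtx v)
  symm := by
    constructor
    rintro u v ⟨hne, (⟨e, he⟩ | ⟨f, h1, h2, h3⟩)⟩
    · exact ⟨hne.symm, Or.inl ⟨e, he.trans Sym2.eq_swap⟩⟩
    · exact ⟨hne.symm, Or.inr ⟨f, h1, h3, h2⟩⟩
  loopless := by constructor; rintro u ⟨hne, -⟩; exact hne rfl

end Multigraph

namespace SimpleGraph

/-- `G` is contained in `X`: `G` is isomorphic to a subgraph of `X`. -/
def IsContainedIn {α β : Type} (G : SimpleGraph α) (X : SimpleGraph β) : Prop :=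
  ∃ f : G →g X, Function.Injective f

/-- The strong product of two simple graphs. -/
def strongProd {α β : Type} (G : SimpleGraph α) (H : SimpleGraph β) :
    SimpleGraph (α × β) where
  Adj x y := x ≠ y ∧ (x.1 = y.1 ∨ G.Adj x.1 y.1) ∧ (x.2 = y.2 ∨ H.Adj x.2 y.2)
  symm := by
    constructor
    rintro x y ⟨hne, h1, h2⟩
    exact ⟨hne.symm, h1.imp Eq.symm (fun h => G.symm.symm _ _ h), h2.imp Eq.symm (fun h => H.symm.symm _ _ h)⟩
  loopless := by constructor; rintro x ⟨hne, -⟩; exact hne rfl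

end SimpleGraph

/-- `G` has treewidth at most `k`: it has a tree-decomposition with all bags of
size at most `k + 1`. -/
def TreewidthLE {α : Type} (G : SimpleGraph α) (k : ℕ) : Prop :=
  ∃ (ι : Type) (T : SimpleGraph ι) (B : ι → Set α),
    T.IsTree ∧
    (∀ v, ∃ i, v ∈ B i) ∧
    (∀ u v, G.Adj u v → ∃ i, u ∈ B i ∧ v ∈ B i) ∧
    (∀ v, (T.induce {i | v ∈ B i}).Connected) ∧
    ∀ i, (B i).encard ≤ (k : ℕ∞) + 1

/-- `G` has Euler genus at most `g`: `G` is (isomorphic to) a subgraph of a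
multigraph having a combinatorial embedding of Euler genus at most `g`. -/
def HasEulerGenusLE {α : Type} (G : SimpleGraph α) (g : ℕ) : Prop :=
  ∃ (V' E' F' : Type), Finite V' ∧ Finite E' ∧ Finite F' ∧
    ∃ (M : Multigraph V' E') (emb : M.Embedding F'),
      emb.eulerGenus ≤ (g : ℤ) ∧ G.IsContainedIn M.simple

/-- A planar graph: a graph of Euler genus `0`. -/
def IsPlanar {α : Type} (G : SimpleGraph α) : Prop := HasEulerGenusLE G 0

/-- An apex graph: deleting some vertex leaves a planar graph. -/
def IsApex {α : Type} (G : SimpleGraph α) : Prop :=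
  ∃ v : α, IsPlanar (G.induce {w | w ≠ v})

/-- `A` indexes a partition of the vertices of `G` into nonempty parts `A x`, and the
quotient of `G` by this partition is (isomorphic to) `H`, via the indexing: this is an
`H`-partition of `G`. -/
def IsHPartition {α W : Type} (G : SimpleGraph α) (H : SimpleGraph W) (A : W → Set α) : Prop :=
  (∀ x, (A x).Nonempty) ∧ (∀ v, ∃! x, v ∈ A x) ∧
    ∀ x y, x ≠ y → (H.Adj x y ↔ ∃ u ∈ A x, ∃ v ∈ A y, G.Adj u v)

/-- `(L 0, L 1, …)` is a layering of `G`: an ordered partition of the vertices such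
that every edge joins vertices in the same or in consecutive layers. -/
def IsLayering {α : Type} (G : SimpleGraph α) (L : ℕ → Set α) : Prop :=
  (∀ v, ∃! j, v ∈ L j) ∧
    ∀ u v, G.Adj u v → ∀ i j, u ∈ L i → v ∈ L j → i ≤ j + 1 ∧ j ≤ i + 1

/-- `b` lies on every walk from `a` to `c` in `T` (for a tree: `b` is on the unique
`a`–`c` path). -/
def BtwIn {α : Type} (T : SimpleGraph α) (a b c : α) : Prop :=
  ∀ p : T.Walk a c, b ∈ p.support

/-- `Q` is the vertex set of a vertical path in the tree `T` rooted at `r` with upper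
end `w` and lower end `u`: `w` lies on the path from `r` to `u`, and `Q` is the set of
vertices of the `w`–`u` path. -/
def IsVerticalPathBtw {α : Type} (T : SimpleGraph α) (r : α) (Q : Set α) (w u : α) : Prop :=
  BtwIn T r w u ∧ Q = {x | BtwIn T w x u}

/-- `Q` is the vertex set of a vertical path in the tree `T` rooted at `r`. -/
def IsVerticalPath {α : Type} (T : SimpleGraph α) (r : α) (Q : Set α) : Prop :=
  ∃ w u, IsVerticalPathBtw T r Q w u

/-- `Y` is the union of at most `k` vertical paths in the tree `T` rooted at `r`. -/
def IsUnionOfVPaths {α : Type} (T : SimpleGraph α) (r : α) (k : ℕ) (Y : Set α) : Prop :=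
  ∃ m, m ≤ k ∧ ∃ Q : Fin m → Set α, (∀ i, IsVerticalPath T r (Q i)) ∧ Y = ⋃ i, Q i

/-- Let `G` be a connected multigraph embedded in a surface without crossings, where each
face is bounded by a cycle, and let `d ≥ 3`.  Every two vertices adjacent in `G^{(d)}`
are at distance at most `⌊d/2⌋` in `G`.  Consequently, grouping the layers of a BFS
layering of `G` (from any root `r`) into consecutive blocks of `⌊d/2⌋` layers yields a
layering of `G^{(d)}`. -/
theorem framed_dist_and_layering (d : ℕ) (hd : 3 ≤ d)
    {V E F : Type} [Fintype V] [Fintype E] [Fintype F]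
    (G : Multigraph V E) (emb : G.Embedding F)
    (hcyc : ∀ f, (emb.boundary f).IsCycle) (r : V) :
    (∀ u v, (Multigraph.framedGraph emb d).Adj u v → G.simple.dist u v ≤ d / 2) ∧
    IsLayering (Multigraph.framedGraph emb d)
      (fun j => {v | j * (d / 2) ≤ G.simple.dist v r ∧
        G.simple.dist v r < (j + 1) * (d / 2)}) := by
  have h1 : ∀ u v, (Multigraph.framedGraph emb d).Adj u v → G.simple.dist u v ≤ d / 2 := by
    rintro u v ⟨hne, (⟨e, he⟩ | ⟨f, hf, ⟨i, hi, rfl⟩, ⟨j, hj, rfl⟩⟩)⟩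
    · have hadj : G.simple.Adj u v := ⟨hne, e, he⟩
      have := SimpleGraph.dist_eq_one_iff_adj.mpr hadj
      omega
    · have key : ∀ (W : G.CWalk) (a k : ℕ),
          G.simple.dist (W.vtx a) (W.vtx (a + k)) ≤ k := by
        intro W a k
        induction k with
        | zero => simp
        | succ k ih =>
          have ht := emb.conn.dist_triangle (u := W.vtx a) (v := W.vtx (a + k))
            (w := W.vtx (a + (k + 1)))
          have hs : G.simple.dist (W.vtx (a + k)) (W.vtx (a + (k + 1))) ≤ 1 := by
            by_cases hq : W.vtx (a + k) = W.vtx (a + (k + 1))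
            · rw [hq]; simp
            · exact le_of_eq (SimpleGraph.dist_eq_one_iff_adj.mpr
                ⟨hq, W.edge (a + k), W.compat (a + k)⟩)
          omega
      have key2 : ∀ (W : G.CWalk), W.len ≤ d → ∀ a b : ℕ, a ≤ b → b < W.len →
          G.simple.dist (W.vtx a) (W.vtx b) ≤ d / 2 := by
        intro W hW a b hab hb
        have k1 := key W a (b - a)
        have k2 := key W b (a + W.len - b)
        rw [show a + (b - a) = b by omega] at k1
        rw [show b + (a + W.len - b) = a + W.len by omega, W.vtx_per,
          SimpleGraph.dist_comm] at k2
        omega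
      rcases le_total i j with h | h
      · exact key2 _ hf i j h hj
      · rw [SimpleGraph.dist_comm]; exact key2 _ hf j i h hi
  refine ⟨h1, ?_, ?_⟩
  · intro v
    have hm : 0 < d / 2 := by omega
    refine ⟨G.simple.dist v r / (d / 2), ⟨Nat.div_mul_le_self _ _, ?_⟩, ?_⟩
    · exact Nat.lt_mul_of_div_lt (Nat.lt_succ_self _) hm
    · rintro j ⟨ha, hb⟩
      exact (Nat.div_eq_of_lt_le ha hb).symm
  · rintro u v huv i j ⟨ha, hb⟩ ⟨hc, he⟩
    have huv1 := h1 u v huv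
    have t1 := emb.conn.dist_triangle (u := u) (v := v) (w := r)
    have t2 := emb.conn.dist_triangle (u := v) (v := u) (w := r)
    rw [SimpleGraph.dist_comm (u := v) (v := u)] at t2
    constructor
    · have : i * (d / 2) < (j + 2) * (d / 2) := by linarith
      have := Nat.lt_of_mul_lt_mul_right this
      omega
    · have : j * (d / 2) < (i + 2) * (d / 2) := by linarith
      have := Nat.lt_of_mul_lt_mul_right this
      omega
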